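/- The alternating group A_6 is isomorphic to PSL_2(F_9). -/

import Mathlib

open Matrix MatrixGroups Pointwise

/-- The action of `SL₂(R)` on matrices by `H ↦ g H gᴴ`, for a commutative star ring `R`. -/
def hermitianCongruence (R : Type*) [CommRing R] [StarRing R] :
    SL(2, R) →* Equiv.Perm (Matrix (Fin 2) (Fin 2) R) :=
  MonoidHom.toHomPerm
    { toFun g H := g.1 * H * g.1ᴴ
      map_one' := by
        funext H
        change 1 * H * 1ᴴ = H
        simp
      map_mul' g h := by
        funext H
        change (g.1 * h.1) * H * (g.1 * h.1)ᴴ = g.1 * (h.1 * H * h.1ᴴ) * g.1ᴴ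
        simp [conjTranspose_mul, Matrix.mul_assoc] }

@[simp]
lemma hermitianCongruence_apply {R : Type*} [CommRing R] [StarRing R] (g : SL(2, R))
    (H : Matrix (Fin 2) (Fin 2) R) : hermitianCongruence R g H = g.1 * H * g.1ᴴ := rfl

lemma hermitianCongruence_eq_one_of_mem_center {R : Type*} [CommRing R] [IsDomain R] [StarRing R]
    {g : SL(2, R)} (hg : g ∈ Subgroup.center SL(2, R)) : hermitianCongruence R g = 1 := by
  obtain ⟨r, hr, h⟩ := Matrix.SpecialLinearGroup.mem_center_iff.1 hg
  ext1 H
  rw [Fintype.card_fin, sq_eq_one_iff] at hr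
  rw [hermitianCongruence_apply, ← h]
  rcases hr with rfl | rfl
  · simp
  · rw [map_neg, map_one]
    simp

lemma card_SL_field (n : ℕ) [NeZero n] (F : Type*) [Field F] :
    Nat.card (SpecialLinearGroup (Fin n) F) * Nat.card Fˣ = Nat.card (GL (Fin n) F) := by
  have hker : (SpecialLinearGroup.toGL (n := Fin n) (R := F)).range =
      (GeneralLinearGroup.det (n := Fin n) (R := F)).ker := by
    ext g
    rw [MonoidHom.mem_range, MonoidHom.mem_ker]
    constructor
    · rintro ⟨x, rfl⟩
      ext
      simp
    · intro hg
      exact ⟨⟨g.1, by simpa using congrArg Units.val hg⟩, Units.ext rfl⟩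
  rw [← Subgroup.card_mul_index (GeneralLinearGroup.det (n := Fin n) (R := F)).ker,
    Subgroup.index_ker, MonoidHom.range_eq_top.2 GeneralLinearGroup.det_surjective,
    Subgroup.card_top, ← hker]
  congr 1
  exact Nat.card_congr (MonoidHom.ofInjective SpecialLinearGroup.toGL_injective).toEquiv

lemma card_center_SL_two {F : Type*} [Field F] (h : (-1 : F) ≠ 1) :
    Nat.card (Subgroup.center SL(2, F)) = 2 := by
  rw [Nat.card_congr SpecialLinearGroup.center_equiv_rootsOfUnity.toEquiv]
  have : IsPrimitiveRoot (-1 : F) 2 := IsPrimitiveRoot.mk_of_lt _ two_pos (by simp) fun l h0 h2 => by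
    obtain rfl : l = 1 := by lia
    simpa using h
  simpa using this.card_rootsOfUnity

lemma card_PSL_two_of_card_eq_nine {F : Type*} [Field F] (hF : Nat.card F = 9) :
    Nat.card (SL(2, F) ⧸ Subgroup.center SL(2, F)) = 360 := by
  have : Finite F := Nat.finite_of_card_ne_zero (by lia)
  have := Fintype.ofFinite F
  have hF' : Fintype.card F = 9 := by rw [← Nat.card_eq_fintype_card, hF]
  have hchar : (-1 : F) ≠ 1 := fun h => by
    have h2 : ringChar F = 2 := by
      by_contra hc
      exact Ring.neg_one_ne_one_of_char_ne_two hc h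
    have := FiniteField.even_card_of_char_two h2
    lia
  have h1 := card_SL_field 2 F
  rw [card_GL_field, Nat.card_units, hF] at h1
  simp only [Fin.prod_univ_two, hF'] at h1
  have h2 := Subgroup.card_eq_card_quotient_mul_card_subgroup (Subgroup.center SL(2, F))
  rw [card_center_SL_two hchar] at h2
  norm_num at h1
  lia

/-- A simple group of half the order of `Sₙ` with a nontrivial action on `n` points is `Aₙ`. -/
lemma nonempty_alternatingGroup_mulEquiv {α G : Type*} [Fintype α] [DecidableEq α] [Group G]
    [IsSimpleGroup G] (hG : 2 * Nat.card G = Nat.card (Equiv.Perm α)) (f : G →* Equiv.Perm α)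
    (hf : f ≠ 1) : Nonempty (alternatingGroup α ≃* G) := by
  have hinj : Function.Injective f := by
    rw [← MonoidHom.ker_eq_bot_iff]
    exact (IsSimpleGroup.eq_bot_or_eq_top_of_normal f.ker inferInstance).resolve_right
      fun h => hf (MonoidHom.ker_eq_top_iff.1 h)
  let e := MonoidHom.ofInjective hinj
  have hindex : f.range.index = 2 := by
    have h := Subgroup.card_mul_index f.range
    rw [← Nat.card_congr e.toEquiv, ← hG, mul_comm] at h
    have : Finite G := Finite.of_injective f hinj
    exact Nat.eq_of_mul_eq_mul_right Nat.card_pos h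
  exact ⟨(MulEquiv.subgroupCongr
    (Equiv.Perm.eq_alternatingGroup_of_index_eq_two hindex).symm).trans e.symm⟩

/-- A group acting on a set and permuting an injective family acts on the indices. -/
lemma exists_hom_perm_of_injective {G X α : Type*} [Group G] [MulAction G X] {f : α → X}
    (hf : Function.Injective f) (h : ∀ (g : G) i, ∃ j, g • f i = f j) :
    ∃ φ : G →* Equiv.Perm α, ∀ g i, g • f i = f (φ g i) := by
  choose σ hσ using h
  refine ⟨MonoidHom.toHomPerm
    { toFun := σ
      map_one' := funext fun i => hf ?_
      map_mul' g g' := funext fun i => hf ?_ }, hσ⟩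
  · rw [← hσ, one_smul]
    rfl
  · rw [← hσ, mul_smul, hσ, hσ]
    rfl

/-- A computable model of the field with nine elements. -/
abbrev GaussianThree : Type := QuadraticAlgebra (ZMod 3) (-1) 0

instance : Fact (∀ r : ZMod 3, r ^ 2 ≠ -1 + 0 * r) := ⟨by decide⟩

namespace GaussianThree

lemma card_eq : Nat.card GaussianThree = 9 := by
  rw [Nat.card_congr (QuadraticAlgebra.equivProd _ _)]
  simp

/-- The Hermitian matrix with diagonal `a`, `d` and upper right entry `x + i y`. -/
def herm (a d x y : ZMod 3) : Matrix (Fin 2) (Fin 2) GaussianThree :=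
  !![⟨a, 0⟩, ⟨x, y⟩; ⟨x, -y⟩, ⟨d, 0⟩]

/-- Quintuples of Hermitian matrices of determinant `-1` with sum zero and constant
pairwise polar form of the determinant; there are six of them up to sign. -/
def quintuple : Fin 6 → Finset (Matrix (Fin 2) (Fin 2) GaussianThree) :=
  ![{herm 0 0 0 1, herm 0 1 0 (-1), herm 1 0 0 (-1), herm 1 1 1 (-1), herm 1 1 (-1) (-1)},
    {herm 0 0 0 1, herm 0 (-1) 0 (-1), herm (-1) 0 0 (-1), herm (-1) (-1) 1 (-1),
      herm (-1) (-1) (-1) (-1)},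
    {herm 0 0 1 0, herm 0 1 (-1) 0, herm 1 0 (-1) 0, herm 1 1 (-1) 1, herm 1 1 (-1) (-1)},
    {herm 0 0 1 0, herm 0 (-1) (-1) 0, herm (-1) 0 (-1) 0, herm (-1) (-1) (-1) 1,
      herm (-1) (-1) (-1) (-1)},
    {herm 0 1 0 1, herm 0 1 0 (-1), herm (-1) 0 1 0, herm (-1) 0 (-1) 0, herm (-1) 1 0 0},
    {herm 0 1 1 0, herm 0 1 (-1) 0, herm (-1) 0 0 1, herm (-1) 0 0 (-1), herm (-1) 1 0 0}]

/-- The six points on which `PSL₂(𝔽₉)` acts: the quintuples up to sign. -/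
def frame (i : Fin 6) : Finset (Matrix (Fin 2) (Fin 2) GaussianThree) :=
  quintuple i ∪ -quintuple i

set_option maxRecDepth 100000 in
lemma frame_injective : Function.Injective frame := by
  unfold Function.Injective
  decide

lemma exists_frame_of_transvection : ∀ (i j : Fin 2) (hij : i ≠ j) (a b : ZMod 3) (k : Fin 6),
    ∃ l, hermitianCongruence GaussianThree (SpecialLinearGroup.transvection hij ⟨a, b⟩) • frame k =
      frame l := by
  decide +kernel

lemma exists_smul_frame (g : SL(2, GaussianThree)) :
    ∀ k, ∃ l, hermitianCongruence GaussianThree g • frame k = frame l := by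
  induction g using SL2.transvection_induction with
  | htransvec i j hij c => exact exists_frame_of_transvection i j hij c.re c.im
  | hmul A B hA hB =>
    intro k
    obtain ⟨l, hl⟩ := hB k
    obtain ⟨m, hm⟩ := hA l
    exact ⟨m, by rw [map_mul, mul_smul, hl, hm]⟩

lemma exists_ne_smul_frame : ∃ k, hermitianCongruence GaussianThree
    (SpecialLinearGroup.transvection zero_ne_one 1) • frame k ≠ frame k := by
  decide +kernel

/-- The action of `SL₂(𝔽)` on the six frames, for a field `𝔽` mapping to the model. -/
lemma exists_hom_perm {F : Type*} [Field F] (e : F →+* GaussianThree) :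
    ∃ φ : SL(2, F) ⧸ Subgroup.center SL(2, F) →* Equiv.Perm (Fin 6), φ ≠ 1 := by
  let ρ := (hermitianCongruence GaussianThree).comp (SpecialLinearGroup.map e)
  obtain ⟨φ, hφ⟩ := exists_hom_perm_of_injective (G := ρ.range) frame_injective <| by
    rintro ⟨_, g, rfl⟩ k
    exact exists_smul_frame _ k
  have hcenter : Subgroup.center SL(2, F) ≤ ρ.rangeRestrict.ker := by
    intro g hg
    rw [MonoidHom.ker_rangeRestrict, MonoidHom.mem_ker]
    apply hermitianCongruence_eq_one_of_mem_center
    obtain ⟨r, hr, h⟩ := Matrix.SpecialLinearGroup.mem_center_iff.1 hg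
    refine Matrix.SpecialLinearGroup.mem_center_iff.2 ⟨e r, by rw [← map_pow, hr, map_one], ?_⟩
    rw [SpecialLinearGroup.map_apply_coe, ← h]
    ext i j : 1
    simp [diagonal_apply, apply_ite e]
  refine ⟨φ.comp (QuotientGroup.lift _ ρ.rangeRestrict hcenter), fun h => ?_⟩
  obtain ⟨k, hk⟩ := exists_ne_smul_frame
  let t : SL(2, F) := SpecialLinearGroup.transvection zero_ne_one 1
  have ht : SpecialLinearGroup.map e t = SpecialLinearGroup.transvection zero_ne_one 1 := by
    apply Subtype.ext
    ext i j : 1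
    fin_cases i <;> fin_cases j <;> simp [t, SpecialLinearGroup.transvection_coe]
  refine hk ?_
  have h1 : φ (ρ.rangeRestrict t) = 1 := DFunLike.congr_fun h (QuotientGroup.mk t)
  have h2 := hφ (ρ.rangeRestrict t) k
  rw [h1, Equiv.Perm.one_apply] at h2
  rw [← ht]
  exact h2

end GaussianThree

/-- The alternating group `A₆` is isomorphic to `PSL₂(𝔽₉)`,
the quotient of `SL₂(𝔽₉)` by its center, where `𝔽₉ = GaloisField 3 2`. -/
theorem stmt_0 :
    Nonempty ((alternatingGroup (Fin 6)) ≃*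
      (Matrix.SpecialLinearGroup (Fin 2) (GaloisField 3 2) ⧸
        Subgroup.center (Matrix.SpecialLinearGroup (Fin 2) (GaloisField 3 2)))) := by
  have hcard : Nat.card (GaloisField 3 2) = 9 := by
    rw [GaloisField.card 3 2 two_ne_zero]
    norm_num
  have : IsSimpleGroup (SL(2, GaloisField 3 2) ⧸ Subgroup.center SL(2, GaloisField 3 2)) :=
    ProjectiveSpecialLinearGroup.rank_two_simple (by lia)
  have := Fintype.ofFinite (GaloisField 3 2)
  have := Fintype.ofEquiv _ (QuadraticAlgebra.equivProd (-1 : ZMod 3) 0).symm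
  have e : GaloisField 3 2 ≃+* GaussianThree := FiniteField.ringEquivOfCardEq <| by
    rw [← Nat.card_eq_fintype_card, ← Nat.card_eq_fintype_card, hcard, GaussianThree.card_eq]
  obtain ⟨φ, hφ⟩ := GaussianThree.exists_hom_perm e.toRingHom
  refine nonempty_alternatingGroup_mulEquiv ?_ φ hφ
  rw [card_PSL_two_of_card_eq_nine hcard, Nat.card_perm, Nat.card_fin]
  rfl
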